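/- arXiv:2109.12681 — 9 statements merged into one kernel-verified Lean document; each statement's English description precedes it below -/
import Mathlib

section
/- Let θ ∈ (0,π) be fixed and let N, R, ω : ℝ → ℝ be differentiable at ℓ₀ ∈ ℝ with N(ℓ₀) > 0 and R(ℓ₀) > 0. Write Ψ_ε(ℓ) = −N(ℓ)/(R(ℓ)·sin θ) − ε·ω(ℓ) for ε ∈ {+1,−1}. Then both derivatives Ψ₊′(ℓ₀) > 0 and Ψ₋′(ℓ₀) > 0 hold if and only if −N′(ℓ₀)/N(ℓ₀) + R′(ℓ₀)/R(ℓ₀) > | (R(ℓ₀)·sin θ / N(ℓ₀))·ω′(ℓ₀) |. -/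
open Real

/-- Characterization of the region M_out: for θ ∈ (0,π) and N, R, ω differentiable
at ℓ₀ with N(ℓ₀) > 0 and R(ℓ₀) > 0, both Ψ₊′(ℓ₀) > 0 and Ψ₋′(ℓ₀) > 0 hold iff
−N′(ℓ₀)/N(ℓ₀) + R′(ℓ₀)/R(ℓ₀) > |(R(ℓ₀)·sin θ/N(ℓ₀))·ω′(ℓ₀)|. -/
theorem mout_characterization (θ : ℝ) (hθ : θ ∈ Set.Ioo 0 π)
    (N R ω : ℝ → ℝ) (ℓ₀ : ℝ)
    (hN : DifferentiableAt ℝ N ℓ₀) (hR : DifferentiableAt ℝ R ℓ₀)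
    (hω : DifferentiableAt ℝ ω ℓ₀)
    (hNpos : 0 < N ℓ₀) (hRpos : 0 < R ℓ₀) :
    (0 < deriv (fun ℓ => -N ℓ / (R ℓ * Real.sin θ) - ω ℓ) ℓ₀ ∧
     0 < deriv (fun ℓ => -N ℓ / (R ℓ * Real.sin θ) + ω ℓ) ℓ₀) ↔
    -deriv N ℓ₀ / N ℓ₀ + deriv R ℓ₀ / R ℓ₀ >
      |R ℓ₀ * Real.sin θ / N ℓ₀ * deriv ω ℓ₀| := by
  have hs : 0 < Real.sin θ := Real.sin_pos_of_mem_Ioo hθ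
  have hc : 0 < N ℓ₀ / (R ℓ₀ * Real.sin θ) := by positivity
  have hΦ : HasDerivAt (fun ℓ => -N ℓ / (R ℓ * Real.sin θ))
      (N ℓ₀ / (R ℓ₀ * Real.sin θ) * (-deriv N ℓ₀ / N ℓ₀ + deriv R ℓ₀ / R ℓ₀)) ℓ₀ := by
    refine (hN.hasDerivAt.fun_neg.fun_div (hR.hasDerivAt.mul_const (Real.sin θ))
      (by positivity)).congr_deriv ?_
    field_simp
    ring
  have hω' : deriv ω ℓ₀ = N ℓ₀ / (R ℓ₀ * Real.sin θ) *
      (R ℓ₀ * Real.sin θ / N ℓ₀ * deriv ω ℓ₀) := by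
    field_simp
  rw [(hΦ.fun_sub hω.hasDerivAt).deriv, (hΦ.fun_add hω.hasDerivAt).deriv, gt_iff_lt, abs_lt]
  nth_rewrite 1 2 [hω']
  rw [← mul_sub, ← mul_add, mul_pos_iff_of_pos_left hc, mul_pos_iff_of_pos_left hc]
  constructor <;> rintro ⟨h₁, h₂⟩ <;> constructor <;> linarith
end

section
/- Let θ ∈ (0,π) be fixed and let N, R, ω : ℝ → ℝ be differentiable at ℓ₀ ∈ ℝ with N(ℓ₀) > 0 and R(ℓ₀) > 0. Write Ψ_ε(ℓ) = −N(ℓ)/(R(ℓ)·sin θ) − ε·ω(ℓ) for ε ∈ {+1,−1}. Then both derivatives Ψ₊′(ℓ₀) < 0 and Ψ₋′(ℓ₀) < 0 hold if and only if −N′(ℓ₀)/N(ℓ₀) + R′(ℓ₀)/R(ℓ₀) < −| (R(ℓ₀)·sin θ / N(ℓ₀))·ω′(ℓ₀) |. -/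
open Real

/-- Characterization of the region M_in: for θ ∈ (0,π) and N, R, ω differentiable
at ℓ₀ with N(ℓ₀) > 0 and R(ℓ₀) > 0, both Ψ₊′(ℓ₀) < 0 and Ψ₋′(ℓ₀) < 0 hold iff
−N′(ℓ₀)/N(ℓ₀) + R′(ℓ₀)/R(ℓ₀) < −|(R(ℓ₀)·sin θ/N(ℓ₀))·ω′(ℓ₀)|. -/
theorem min_characterization (θ : ℝ) (hθ : θ ∈ Set.Ioo 0 π)
    (N R ω : ℝ → ℝ) (ℓ₀ : ℝ)
    (hN : DifferentiableAt ℝ N ℓ₀) (hR : DifferentiableAt ℝ R ℓ₀)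
    (hω : DifferentiableAt ℝ ω ℓ₀)
    (hNpos : 0 < N ℓ₀) (hRpos : 0 < R ℓ₀) :
    (deriv (fun ℓ => -N ℓ / (R ℓ * Real.sin θ) - ω ℓ) ℓ₀ < 0 ∧
     deriv (fun ℓ => -N ℓ / (R ℓ * Real.sin θ) + ω ℓ) ℓ₀ < 0) ↔
    -deriv N ℓ₀ / N ℓ₀ + deriv R ℓ₀ / R ℓ₀ <
      -|R ℓ₀ * Real.sin θ / N ℓ₀ * deriv ω ℓ₀| := by
  have hs : 0 < Real.sin θ := Real.sin_pos_of_mem_Ioo hθ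
  have hk : 0 < N ℓ₀ / (R ℓ₀ * Real.sin θ) := by positivity
  have hF : HasDerivAt (fun ℓ => -N ℓ / (R ℓ * Real.sin θ))
      (N ℓ₀ / (R ℓ₀ * Real.sin θ) * (-deriv N ℓ₀ / N ℓ₀ + deriv R ℓ₀ / R ℓ₀)) ℓ₀ := by
    refine (hN.hasDerivAt.fun_neg.fun_div (hR.hasDerivAt.mul_const (Real.sin θ))
      (by positivity)).congr_deriv ?_
    field_simp
    ring
  have hω' : deriv ω ℓ₀ =
      N ℓ₀ / (R ℓ₀ * Real.sin θ) * (R ℓ₀ * Real.sin θ / N ℓ₀ * deriv ω ℓ₀) := by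
    field_simp
  rw [(hF.fun_sub hω.hasDerivAt).deriv, (hF.fun_add hω.hasDerivAt).deriv, lt_neg, abs_lt, neg_neg]
  generalize R ℓ₀ * Real.sin θ / N ℓ₀ * deriv ω ℓ₀ = B at hω' ⊢
  have hneg (x : ℝ) : N ℓ₀ / (R ℓ₀ * Real.sin θ) * x < 0 ↔ x < 0 := smul_neg_iff_of_pos_left hk
  rw [hω', ← mul_sub, ← mul_add, hneg, hneg]
  constructor <;> rintro ⟨h₁, h₂⟩ <;> constructor <;> linarith
end

section
/- Let θ ∈ (0,π) be fixed and ε ∈ {+1,−1}. Let N, R, ω : ℝ → ℝ be differentiable functions satisfying, as ℓ → +∞: N(ℓ) − 1 = O(1/ℓ), R(ℓ)/ℓ − 1 = O(1/ℓ), ω(ℓ) = O(1/ℓ²), N′(ℓ) = O(1/ℓ²), R′(ℓ) − 1 = O(1/ℓ), ω′(ℓ) = O(1/ℓ³), with N(ℓ) > 0 and R(ℓ) > 0 for all sufficiently large ℓ. Then the derivative of the potential Ψ_ε(ℓ) = −N(ℓ)/(R(ℓ)·sin θ) − ε·ω(ℓ) satisfies Ψ_ε′(ℓ) − 1/(ℓ²·sin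 θ) = O(1/ℓ³) as ℓ → +∞; in particular there exists ℓ₂ such that Ψ_ε′(ℓ) > 0 for all ℓ > ℓ₂. -/
open Real Filter Asymptotics

section OneAddBigO

variable {α : Type*} {l : Filter α} {f g u : α → ℝ}

theorem isBigO_one_of_sub_one (hu : Tendsto u l (nhds 0))
    (hf : (fun x => f x - 1) =O[l] u) : f =O[l] fun _ => (1 : ℝ) := by
  have h := (hf.trans_tendsto hu).add_const 1
  simp only [sub_add_cancel, zero_add] at h
  exact h.isBigO_one ℝ

theorem isBigO_mul_sub_one (hu : Tendsto u l (nhds 0))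
    (hf : (fun x => f x - 1) =O[l] u) (hg : (fun x => g x - 1) =O[l] u) :
    (fun x => f x * g x - 1) =O[l] u := by
  have h := (hf.mul (isBigO_one_of_sub_one hu hg)).congr_right fun x => mul_one (u x)
  exact (h.add hg).congr_left fun x => by ring

theorem isBigO_inv_sub_one (hu : Tendsto u l (nhds 0))
    (hf : (fun x => f x - 1) =O[l] u) : (fun x => (f x)⁻¹ - 1) =O[l] u := by
  have hlim := (hf.trans_tendsto hu).add_const 1
  simp only [sub_add_cancel, zero_add] at hlim
  have hinv := (hlim.inv₀ one_ne_zero).isBigO_one ℝ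
  have h := (hf.mul hinv).neg_left.congr_right fun x => mul_one (u x)
  refine h.congr' ?_ EventuallyEq.rfl
  filter_upwards [hlim.eventually_ne one_ne_zero] with x hx
  field_simp
  ring

end OneAddBigO

theorem eventually_pos_of_sub_isBigO {f : ℝ → ℝ} {s : ℝ} (hs : 0 < s)
    (h : (fun x => f x - 1 / (x ^ 2 * s)) =O[atTop] fun x => 1 / x ^ 3) :
    ∀ᶠ x in atTop, 0 < f x := by
  obtain ⟨C, hC⟩ := h.bound
  filter_upwards [hC, eventually_gt_atTop 0, eventually_gt_atTop (C * s)] with x hx hx0 hxC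
  rw [Real.norm_eq_abs, Real.norm_of_nonneg (by positivity)] at hx
  have hlt : C * (1 / x ^ 3) < 1 / (x ^ 2 * s) := by
    rw [mul_one_div, div_lt_div_iff₀ (by positivity) (by positivity)]
    nlinarith [mul_lt_mul_of_pos_left hxC (pow_pos hx0 2)]
  linarith [(abs_le.mp hx).1]

theorem deriv_potential {N R ω : ℝ → ℝ} {s ε x : ℝ} (hN : DifferentiableAt ℝ N x)
    (hR : DifferentiableAt ℝ R x) (hω : DifferentiableAt ℝ ω x) (hs : s ≠ 0) (hx : R x ≠ 0) :
    deriv (fun y => -N y / (R y * s) - ε * ω y) x =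
      (N x * deriv R x / R x ^ 2 - deriv N x / R x) / s - ε * deriv ω x := by
  have h := (hN.hasDerivAt.neg.div (hR.hasDerivAt.mul_const s)
    (mul_ne_zero hx hs)).sub (hω.hasDerivAt.const_mul ε)
  refine h.deriv.trans ?_
  simp only [Pi.neg_apply]
  field_simp
  ring

/-- Asymptotic behaviour of the derivative of the potential Ψ_ε at the end
ℓ → +∞: under asymptotic flatness conditions on N, R, ω and their derivatives,
one has Ψ_ε′(ℓ) − 1/(ℓ²·sin θ) = O(1/ℓ³); in particular there exists ℓ₂ such
that Ψ_ε′(ℓ) > 0 for all ℓ > ℓ₂ (part (b) of Proposition 3). -/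
theorem psi_deriv_asymptotics (θ : ℝ) (hθ : θ ∈ Set.Ioo 0 π) (ε : ℝ)
    (hε : ε = 1 ∨ ε = -1) (N R ω : ℝ → ℝ)
    (hNdiff : Differentiable ℝ N) (hRdiff : Differentiable ℝ R)
    (hωdiff : Differentiable ℝ ω)
    (hN : (fun ℓ => N ℓ - 1) =O[atTop] fun ℓ => 1 / ℓ)
    (hR : (fun ℓ => R ℓ / ℓ - 1) =O[atTop] fun ℓ => 1 / ℓ)
    (hω : ω =O[atTop] fun ℓ => 1 / ℓ ^ 2)
    (hN' : deriv N =O[atTop] fun ℓ => 1 / ℓ ^ 2)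
    (hR' : (fun ℓ => deriv R ℓ - 1) =O[atTop] fun ℓ => 1 / ℓ)
    (hω' : deriv ω =O[atTop] fun ℓ => 1 / ℓ ^ 3)
    (hNpos : ∀ᶠ ℓ in atTop, 0 < N ℓ) (hRpos : ∀ᶠ ℓ in atTop, 0 < R ℓ) :
    ((fun ℓ => deriv (fun x => -N x / (R x * Real.sin θ) - ε * ω x) ℓ
        - 1 / (ℓ ^ 2 * Real.sin θ)) =O[atTop] fun ℓ => 1 / ℓ ^ 3) ∧
    ∃ ℓ₂ : ℝ, ∀ ℓ > ℓ₂,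
      0 < deriv (fun x => -N x / (R x * Real.sin θ) - ε * ω x) ℓ := by
  have hs : 0 < Real.sin θ := Real.sin_pos_of_mem_Ioo hθ
  have hu : Tendsto (fun ℓ : ℝ => 1 / ℓ) atTop (nhds 0) := by
    simpa only [one_div] using tendsto_inv_atTop_zero (𝕜 := ℝ)
  have hq := isBigO_inv_sub_one hu hR
  have hmain := isBigO_mul_sub_one hu (isBigO_mul_sub_one hu hN hR')
    (isBigO_mul_sub_one hu hq hq)
  have hmain' := ((isBigO_refl (fun ℓ : ℝ => 1 / ℓ ^ 2) atTop).mul hmain).const_mul_left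
    (Real.sin θ)⁻¹
  have hlapse := ((hN'.mul (isBigO_refl (fun ℓ : ℝ => 1 / ℓ) atTop)).mul
    (isBigO_one_of_sub_one hu hq)).const_mul_left (Real.sin θ)⁻¹
  have hpow : ∀ ℓ : ℝ, 1 / ℓ ^ 2 * (1 / ℓ) = 1 / ℓ ^ 3 := fun ℓ => by
    rw [one_div_mul_one_div, ← pow_succ]
  simp only [mul_one, hpow] at hmain' hlapse
  have key : (fun ℓ => deriv (fun x => -N x / (R x * Real.sin θ) - ε * ω x) ℓ
      - 1 / (ℓ ^ 2 * Real.sin θ)) =O[atTop] fun ℓ => 1 / ℓ ^ 3 := by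
    refine ((hmain'.sub hlapse).sub (hω'.const_mul_left ε)).congr' ?_ EventuallyEq.rfl
    filter_upwards [hRpos, eventually_gt_atTop 0] with ℓ hRℓ hℓ
    rw [deriv_potential (hNdiff ℓ) (hRdiff ℓ) (hωdiff ℓ) hs.ne' hRℓ.ne']
    field_simp
    ring
  obtain ⟨ℓ₂, hℓ₂⟩ := eventually_atTop.mp (eventually_pos_of_sub_isBigO hs key)
  exact ⟨key, ℓ₂, fun ℓ hℓ => hℓ₂ ℓ hℓ.le⟩
end

section
/- Let r₀ > 0 and a > 0 with 6a > r₀². Then for (ℓ,θ) ∈ ℝ × (0,π), the point (ℓ,θ) is a critical point of Ψ₋ (i.e., both partial derivatives ∂_ℓΨ₋(ℓ,θ) and ∂_θΨ₋(ℓ,θ) vanish) if and only if θ = π/2 and ℓ ∈ {0, √(6a−r₀²), −√(6a−r₀²)}. -/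
open Real

/-- Example 1 counter-rotating potential Ψ₋(ℓ,θ) = −(ℓ² + r₀² − 2a sin θ)/((ℓ²+r₀²)^{3/2} sin θ). -/
noncomputable def PsiMinusEx1 (r₀ a ℓ θ : ℝ) : ℝ :=
  -(ℓ ^ 2 + r₀ ^ 2 - 2 * a * Real.sin θ) /
    (Real.sqrt (ℓ ^ 2 + r₀ ^ 2) ^ 3 * Real.sin θ)

theorem hasDerivAt_PsiMinusEx1_left {r₀ : ℝ} (hr₀ : 0 < r₀) (a ℓ : ℝ) {θ : ℝ}
    (hθ : Real.sin θ ≠ 0) :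
    HasDerivAt (fun x => PsiMinusEx1 r₀ a x θ)
      (ℓ * (ℓ ^ 2 + r₀ ^ 2 - 6 * a * Real.sin θ) /
        (Real.sqrt (ℓ ^ 2 + r₀ ^ 2) ^ 5 * Real.sin θ)) ℓ := by
  have hD : 0 < ℓ ^ 2 + r₀ ^ 2 := by positivity
  have hs : Real.sqrt (ℓ ^ 2 + r₀ ^ 2) ≠ 0 := (Real.sqrt_pos.2 hD).ne'
  have hsq := Real.sq_sqrt hD.le
  have hpoly : HasDerivAt (fun x : ℝ => x ^ 2 + r₀ ^ 2) (2 * ℓ) ℓ := by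
    simpa using (hasDerivAt_pow 2 ℓ).add_const (r₀ ^ 2)
  have hnum := (hpoly.sub_const (2 * a * Real.sin θ)).fun_neg
  have hden := ((hpoly.sqrt hD.ne').fun_pow 3).mul_const (Real.sin θ)
  have hquot := hnum.fun_div hden (mul_ne_zero (pow_ne_zero 3 hs) hθ)
  refine hquot.congr_deriv ?_
  set s := Real.sqrt (ℓ ^ 2 + r₀ ^ 2)
  rw [← hsq]
  field_simp
  ring

theorem hasDerivAt_PsiMinusEx1_right {r₀ : ℝ} (hr₀ : 0 < r₀) (a ℓ : ℝ) {θ : ℝ}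
    (hθ : Real.sin θ ≠ 0) :
    HasDerivAt (fun ϑ => PsiMinusEx1 r₀ a ℓ ϑ)
      (Real.cos θ / (Real.sin θ ^ 2 * Real.sqrt (ℓ ^ 2 + r₀ ^ 2))) θ := by
  have hD : 0 < ℓ ^ 2 + r₀ ^ 2 := by positivity
  have hs : Real.sqrt (ℓ ^ 2 + r₀ ^ 2) ≠ 0 := (Real.sqrt_pos.2 hD).ne'
  have hsq := Real.sq_sqrt hD.le
  have hsin := Real.hasDerivAt_sin θ
  have hnum := ((hsin.const_mul (2 * a)).const_sub (ℓ ^ 2 + r₀ ^ 2)).fun_neg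
  have hden := hsin.const_mul (Real.sqrt (ℓ ^ 2 + r₀ ^ 2) ^ 3)
  have hquot := hnum.fun_div hden (mul_ne_zero (pow_ne_zero 3 hs) hθ)
  refine hquot.congr_deriv ?_
  set s := Real.sqrt (ℓ ^ 2 + r₀ ^ 2)
  rw [← hsq]
  field_simp
  ring

/-- Example 1, case 6a > r₀²: the critical points of Ψ₋ on ℝ × (0,π) are exactly
the three counter-rotating photon circles at θ = π/2, ℓ ∈ {0, ±√(6a−r₀²)}. -/
theorem example1_critical_points_minus (r₀ a : ℝ) (hr₀ : 0 < r₀) (ha : 0 < a)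
    (hcase : r₀ ^ 2 < 6 * a) (ℓ θ : ℝ) (hθ : θ ∈ Set.Ioo 0 π) :
    (deriv (fun x => PsiMinusEx1 r₀ a x θ) ℓ = 0 ∧
     deriv (fun ϑ => PsiMinusEx1 r₀ a ℓ ϑ) θ = 0) ↔
    (θ = π / 2 ∧ (ℓ = 0 ∨ ℓ = Real.sqrt (6 * a - r₀ ^ 2) ∨
      ℓ = -Real.sqrt (6 * a - r₀ ^ 2))) := by
  have hsin : Real.sin θ ≠ 0 := (Real.sin_pos_of_mem_Ioo hθ).ne'
  have hs : Real.sqrt (ℓ ^ 2 + r₀ ^ 2) ≠ 0 := (Real.sqrt_pos.2 (by positivity)).ne'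
  have hcos : Real.cos θ = 0 ↔ θ = π / 2 := by
    refine ⟨fun h => ?_, fun h => h ▸ Real.cos_pi_div_two⟩
    exact Real.injOn_cos ⟨hθ.1.le, hθ.2.le⟩ ⟨by positivity, by linarith [Real.pi_pos]⟩
      (h.trans Real.cos_pi_div_two.symm)
  have hroot : ℓ ^ 2 + r₀ ^ 2 - 6 * a = 0 ↔
      ℓ = Real.sqrt (6 * a - r₀ ^ 2) ∨ ℓ = -Real.sqrt (6 * a - r₀ ^ 2) := by
    rw [← sq_eq_sq_iff_eq_or_eq_neg, Real.sq_sqrt (by linarith)]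
    constructor <;> intro h <;> linarith
  rw [(hasDerivAt_PsiMinusEx1_left hr₀ a ℓ hsin).deriv,
    (hasDerivAt_PsiMinusEx1_right hr₀ a ℓ hsin).deriv,
    div_eq_zero_iff, or_iff_left (mul_ne_zero (pow_ne_zero 5 hs) hsin),
    div_eq_zero_iff, or_iff_left (mul_ne_zero (pow_ne_zero 2 hsin) hs),
    hcos, and_comm, mul_eq_zero]
  refine and_congr_right fun h => ?_
  rw [h, Real.sin_pi_div_two, mul_one, hroot]
end

section
/- Let r₀ > 0 and a > 0. Then for (ℓ,θ) ∈ ℝ × (0,π), the point (ℓ,θ) is a critical point of Ψ₊ (i.e., both partial derivatives ∂_ℓΨ₊(ℓ,θ) and ∂_θΨ₊(ℓ,θ) vanish) if and only if ℓ = 0 and θ = π/2. -/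
open Real

/-- Example 1 co-rotating potential Ψ₊(ℓ,θ) = −(ℓ² + r₀² + 2a sin θ)/((ℓ²+r₀²)^{3/2} sin θ). -/
noncomputable def PsiPlusEx1 (r₀ a ℓ θ : ℝ) : ℝ :=
  -(ℓ ^ 2 + r₀ ^ 2 + 2 * a * Real.sin θ) /
    (Real.sqrt (ℓ ^ 2 + r₀ ^ 2) ^ 3 * Real.sin θ)

theorem hasDerivAt_PsiPlusEx1_left {r₀ a θ : ℝ} (hr₀ : 0 < r₀) (hs : Real.sin θ ≠ 0) (ℓ : ℝ) :
    HasDerivAt (fun x => PsiPlusEx1 r₀ a x θ)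
      (ℓ * (ℓ ^ 2 + r₀ ^ 2 + 6 * a * Real.sin θ) /
        (Real.sqrt (ℓ ^ 2 + r₀ ^ 2) ^ 5 * Real.sin θ)) ℓ := by
  have hS : 0 < ℓ ^ 2 + r₀ ^ 2 := by positivity
  have hR : Real.sqrt (ℓ ^ 2 + r₀ ^ 2) ≠ 0 := (Real.sqrt_pos.2 hS).ne'
  have hsq : ℓ ^ 2 + r₀ ^ 2 = Real.sqrt (ℓ ^ 2 + r₀ ^ 2) ^ 2 := (Real.sq_sqrt hS.le).symm
  have hp : HasDerivAt (fun x : ℝ => x ^ 2 + r₀ ^ 2) (2 * ℓ) ℓ := by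
    simpa using (hasDerivAt_pow 2 ℓ).add_const (r₀ ^ 2)
  have hnum := (hp.add_const (2 * a * Real.sin θ)).fun_neg
  have hden := ((hp.sqrt hS.ne').fun_pow 3).mul_const (Real.sin θ)
  refine (hnum.fun_div hden (mul_ne_zero (pow_ne_zero 3 hR) hs)).congr_deriv ?_
  generalize Real.sqrt (ℓ ^ 2 + r₀ ^ 2) = R at hR hsq ⊢
  rw [hsq]
  field_simp
  ring

theorem hasDerivAt_PsiPlusEx1_right {r₀ a θ : ℝ} (hr₀ : 0 < r₀) (hs : Real.sin θ ≠ 0) (ℓ : ℝ) :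
    HasDerivAt (fun ϑ => PsiPlusEx1 r₀ a ℓ ϑ)
      (Real.cos θ / (Real.sin θ ^ 2 * Real.sqrt (ℓ ^ 2 + r₀ ^ 2))) θ := by
  have hS : 0 < ℓ ^ 2 + r₀ ^ 2 := by positivity
  have hR : Real.sqrt (ℓ ^ 2 + r₀ ^ 2) ≠ 0 := (Real.sqrt_pos.2 hS).ne'
  have hsq : ℓ ^ 2 + r₀ ^ 2 = Real.sqrt (ℓ ^ 2 + r₀ ^ 2) ^ 2 := (Real.sq_sqrt hS.le).symm
  have hnum :=
    (((Real.hasDerivAt_sin θ).const_mul (2 * a)).const_add (ℓ ^ 2 + r₀ ^ 2)).fun_neg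
  have hden := (Real.hasDerivAt_sin θ).const_mul (Real.sqrt (ℓ ^ 2 + r₀ ^ 2) ^ 3)
  refine (hnum.fun_div hden (mul_ne_zero (pow_ne_zero 3 hR) hs)).congr_deriv ?_
  generalize Real.sqrt (ℓ ^ 2 + r₀ ^ 2) = R at hR hsq ⊢
  rw [hsq]
  field_simp
  ring

/-- Example 1: for every a > 0 the only critical point of Ψ₊ on ℝ × (0,π) is the
co-rotating photon circle at ℓ = 0, θ = π/2. -/
theorem example1_critical_points_plus (r₀ a : ℝ) (hr₀ : 0 < r₀) (ha : 0 < a)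
    (ℓ θ : ℝ) (hθ : θ ∈ Set.Ioo 0 π) :
    (deriv (fun x => PsiPlusEx1 r₀ a x θ) ℓ = 0 ∧
     deriv (fun ϑ => PsiPlusEx1 r₀ a ℓ ϑ) θ = 0) ↔ (ℓ = 0 ∧ θ = π / 2) := by
  have hs : 0 < Real.sin θ := Real.sin_pos_of_mem_Ioo hθ
  have hR : 0 < Real.sqrt (ℓ ^ 2 + r₀ ^ 2) := Real.sqrt_pos.2 (by positivity)
  have hfactor : 0 < ℓ ^ 2 + r₀ ^ 2 + 6 * a * Real.sin θ := by positivity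
  rw [(hasDerivAt_PsiPlusEx1_left hr₀ hs.ne' ℓ).deriv,
    (hasDerivAt_PsiPlusEx1_right hr₀ hs.ne' ℓ).deriv,
    div_eq_zero_iff, or_iff_left (by positivity), mul_eq_zero, or_iff_left hfactor.ne',
    div_eq_zero_iff, or_iff_left (by positivity)]
  refine and_congr_right fun _ => ⟨fun hcos => ?_, fun h => h ▸ Real.cos_pi_div_two⟩
  refine Real.injOn_cos ⟨hθ.1.le, hθ.2.le⟩ ⟨by positivity, by linarith [Real.pi_pos]⟩ ?_
  rw [hcos, Real.cos_pi_div_two]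
end

section
/- Let r₀ > 0 and a > 0 with 6a > r₀². Then the point (ℓ,θ) = (0, π/2) is a strict local maximum of the function Ψ₋ : ℝ × (0,π) → ℝ, Ψ₋(ℓ,θ) = −(ℓ² + r₀² − 2a·sin θ)/((ℓ²+r₀²)^{3/2}·sin θ); i.e., there is a neighborhood of (0, π/2) in ℝ × (0,π) on which Ψ₋(ℓ,θ) < Ψ₋(0, π/2) for all (ℓ,θ) ≠ (0, π/2). -/
open Real

/-- In terms of `v = 1 / √(ℓ² + r₀²)`, the potential is `2 a v³ - v / sin θ`. -/
lemma psiMinusEx1_eq {r₀ a ℓ θ : ℝ} (hr₀ : 0 < r₀) (hθ : 0 < sin θ) :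
    PsiMinusEx1 r₀ a ℓ θ =
      2 * a * (√(ℓ ^ 2 + r₀ ^ 2))⁻¹ ^ 3 - (√(ℓ ^ 2 + r₀ ^ 2))⁻¹ / sin θ := by
  have hR : 0 < √(ℓ ^ 2 + r₀ ^ 2) := sqrt_pos.2 (by positivity)
  have hsq : √(ℓ ^ 2 + r₀ ^ 2) ^ 2 = ℓ ^ 2 + r₀ ^ 2 := sq_sqrt (by positivity)
  unfold PsiMinusEx1
  rw [← hsq, sqrt_sq hR.le]
  field_simp
  ring

/-- The cubic `2 a v³ - v` is strictly increasing where `1 < 6 a v²`, `v > 0`. -/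
lemma two_mul_cube_sub_lt {a u v : ℝ} (hv : 0 < v) (huv : v < u) (h : 1 < 6 * a * v ^ 2) :
    2 * a * v ^ 3 - v < 2 * a * u ^ 3 - u := by
  have ha : 0 < a := by
    by_contra! ha
    nlinarith [sq_nonneg v]
  have hsum : 3 * v ^ 2 ≤ u ^ 2 + u * v + v ^ 2 := by nlinarith
  have hfactor : 0 < 2 * a * (u ^ 2 + u * v + v ^ 2) - 1 := by nlinarith
  nlinarith [mul_pos (sub_pos.2 huv) hfactor]

lemma sin_lt_one_of_mem_Ioo_of_ne {θ : ℝ} (hθ : θ ∈ Set.Ioo 0 π) (hne : θ ≠ π / 2) :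
    sin θ < 1 := by
  refine lt_of_le_of_ne (sin_le_one θ) fun h ↦ hne ?_
  rw [← cos_sub_pi_div_two,
    cos_eq_one_iff_of_lt_of_lt (by linarith [hθ.1, pi_pos]) (by linarith [hθ.2, pi_pos])] at h
  linarith

/-- Example 1, case 6a > r₀²: the counter-rotating photon circle at (0, π/2) is a
strict local maximum of Ψ₋ on ℝ × (0,π). -/
theorem example1_strict_local_max_minus (r₀ a : ℝ) (hr₀ : 0 < r₀) (ha : 0 < a)
    (hcase : r₀ ^ 2 < 6 * a) :
    ∃ δ > (0 : ℝ), ∀ ℓ θ : ℝ, |ℓ| < δ → |θ - π / 2| < δ → θ ∈ Set.Ioo 0 π →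
      ¬(ℓ = 0 ∧ θ = π / 2) →
      PsiMinusEx1 r₀ a ℓ θ < PsiMinusEx1 r₀ a 0 (π / 2) := by
  refine ⟨√(6 * a - r₀ ^ 2), sqrt_pos.2 (by linarith), fun ℓ θ hℓ _ hθ hne ↦ ?_⟩
  have hs : 0 < sin θ := sin_pos_of_mem_Ioo hθ
  have hℓsq : ℓ ^ 2 < 6 * a - r₀ ^ 2 := by
    rw [← sq_abs]
    exact (lt_sqrt (abs_nonneg ℓ)).1 hℓ
  have hR : 0 < √(ℓ ^ 2 + r₀ ^ 2) := sqrt_pos.2 (by positivity)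
  have hsq : √(ℓ ^ 2 + r₀ ^ 2) ^ 2 = ℓ ^ 2 + r₀ ^ 2 := sq_sqrt (by positivity)
  rw [psiMinusEx1_eq hr₀ hs, psiMinusEx1_eq hr₀ (by simp), sin_pi_div_two, div_one,
    zero_pow two_ne_zero, zero_add, sqrt_sq hr₀.le]
  have hv : 0 < (√(ℓ ^ 2 + r₀ ^ 2))⁻¹ := inv_pos.2 hR
  by_cases hℓ0 : ℓ = 0
  · subst hℓ0
    have hs1 := sin_lt_one_of_mem_Ioo_of_ne hθ fun h ↦ hne ⟨rfl, h⟩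
    rw [zero_pow two_ne_zero, zero_add, sqrt_sq hr₀.le]
    have := (lt_div_iff₀ hs).2 (mul_lt_of_lt_one_right (inv_pos.2 hr₀) hs1)
    linarith
  · have hlt : r₀ < √(ℓ ^ 2 + r₀ ^ 2) :=
      lt_sqrt_of_sq_lt (lt_add_of_pos_left _ (by positivity))
    have hcubic := two_mul_cube_sub_lt (a := a) hv (inv_strictAnti₀ hr₀ hlt) (by
      rw [inv_pow, hsq, ← div_eq_mul_inv, one_lt_div (by positivity)]
      linarith)
    have := (le_div_iff₀ hs).2 (mul_le_of_le_one_right hv.le (sin_le_one θ))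
    linarith
end

section
/- Let r₀ > 0 and a ≥ 0. Then the point (ℓ,θ) = (0, π/2) is a saddle point of the function Ψ₊ : ℝ × (0,π) → ℝ, Ψ₊(ℓ,θ) = −(ℓ² + r₀² + 2a·sin θ)/((ℓ²+r₀²)^{3/2}·sin θ): it is a critical point, but in every neighborhood of (0, π/2) there exist points with Ψ₊-value strictly greater than Ψ₊(0, π/2) and points with Ψ₊-value strictly smaller than Ψ₊(0, π/2); in particular it is neither a local maximum nor a local minimum. -/
open Real

/-- Away from the degenerate locus, the potential splits into a centrifugal and a Coriolis part. -/
lemma PsiPlusEx1_eq_neg_inv_add {r₀ θ : ℝ} (a ℓ : ℝ) (hr₀ : r₀ ≠ 0) (hθ : sin θ ≠ 0) :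
    PsiPlusEx1 r₀ a ℓ θ =
      -(1 / (√(ℓ ^ 2 + r₀ ^ 2) * sin θ) + 2 * a / √(ℓ ^ 2 + r₀ ^ 2) ^ 3) := by
  have hpos : 0 < ℓ ^ 2 + r₀ ^ 2 := by positivity
  have hs : √(ℓ ^ 2 + r₀ ^ 2) ≠ 0 := (sqrt_pos.2 hpos).ne'
  have hsq : √(ℓ ^ 2 + r₀ ^ 2) ^ 2 = ℓ ^ 2 + r₀ ^ 2 := sq_sqrt hpos.le
  unfold PsiPlusEx1
  rw [← hsq, sqrt_sq (sqrt_nonneg _)]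
  field_simp

lemma PsiPlusEx1_neg (r₀ a ℓ θ : ℝ) : PsiPlusEx1 r₀ a (-ℓ) θ = PsiPlusEx1 r₀ a ℓ θ := by
  simp [PsiPlusEx1]

lemma PsiPlusEx1_pi_sub (r₀ a ℓ θ : ℝ) :
    PsiPlusEx1 r₀ a ℓ (π - θ) = PsiPlusEx1 r₀ a ℓ θ := by
  simp [PsiPlusEx1]

lemma deriv_PsiPlusEx1_radial (r₀ a θ : ℝ) : deriv (fun x => PsiPlusEx1 r₀ a x θ) 0 = 0 := by
  have h := deriv_comp_neg (fun x => PsiPlusEx1 r₀ a x θ) 0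
  simp only [PsiPlusEx1_neg, neg_zero] at h
  linarith

lemma deriv_PsiPlusEx1_latitudinal (r₀ a ℓ : ℝ) :
    deriv (fun ϑ => PsiPlusEx1 r₀ a ℓ ϑ) (π / 2) = 0 := by
  have h := deriv_comp_const_sub (fun ϑ => PsiPlusEx1 r₀ a ℓ ϑ) π (π / 2)
  simp only [PsiPlusEx1_pi_sub, sub_half] at h
  linarith

lemma PsiPlusEx1_lt_of_radial_ne_zero {r₀ a ℓ : ℝ} (hr₀ : 0 < r₀) (ha : 0 ≤ a) (hℓ : ℓ ≠ 0) :
    PsiPlusEx1 r₀ a 0 (π / 2) < PsiPlusEx1 r₀ a ℓ (π / 2) := by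
  have hsin : sin (π / 2) ≠ 0 := by simp
  rw [PsiPlusEx1_eq_neg_inv_add a 0 hr₀.ne' hsin, PsiPlusEx1_eq_neg_inv_add a ℓ hr₀.ne' hsin]
  have hlt : r₀ < √(ℓ ^ 2 + r₀ ^ 2) := lt_sqrt_of_sq_lt (by linarith [sq_pos_of_ne_zero hℓ])
  simp only [sin_pi_div_two, mul_one, ne_eq, OfNat.ofNat_ne_zero, not_false_eq_true, zero_pow,
    zero_add, sqrt_sq hr₀.le]
  exact neg_lt_neg (add_lt_add_of_lt_of_le (by gcongr) (by gcongr))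

lemma PsiPlusEx1_lt_of_sin_lt_one {r₀ θ : ℝ} (a ℓ : ℝ) (hr₀ : r₀ ≠ 0) (hpos : 0 < sin θ)
    (hlt : sin θ < 1) : PsiPlusEx1 r₀ a ℓ θ < PsiPlusEx1 r₀ a ℓ (π / 2) := by
  rw [PsiPlusEx1_eq_neg_inv_add a ℓ hr₀ hpos.ne', PsiPlusEx1_eq_neg_inv_add a ℓ hr₀ (by simp),
    sin_pi_div_two]
  have hs : 0 < √(ℓ ^ 2 + r₀ ^ 2) := sqrt_pos.2 (by positivity)
  gcongr

/-- Example 1: the co-rotating photon circle at (0, π/2) is a saddle point of Ψ₊: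
it is a critical point, but every neighborhood contains points with strictly
larger and points with strictly smaller Ψ₊-value. -/
theorem example1_saddle_plus (r₀ a : ℝ) (hr₀ : 0 < r₀) (ha : 0 ≤ a) :
    (deriv (fun x => PsiPlusEx1 r₀ a x (π / 2)) 0 = 0 ∧
     deriv (fun ϑ => PsiPlusEx1 r₀ a 0 ϑ) (π / 2) = 0) ∧
    (∀ δ > (0 : ℝ),
      (∃ ℓ θ : ℝ, |ℓ| < δ ∧ |θ - π / 2| < δ ∧ θ ∈ Set.Ioo 0 π ∧
        PsiPlusEx1 r₀ a 0 (π / 2) < PsiPlusEx1 r₀ a ℓ θ) ∧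
      (∃ ℓ θ : ℝ, |ℓ| < δ ∧ |θ - π / 2| < δ ∧ θ ∈ Set.Ioo 0 π ∧
        PsiPlusEx1 r₀ a ℓ θ < PsiPlusEx1 r₀ a 0 (π / 2))) := by
  refine ⟨⟨deriv_PsiPlusEx1_radial r₀ a _, deriv_PsiPlusEx1_latitudinal r₀ a 0⟩,
    fun δ hδ => ⟨⟨δ / 2, π / 2, ?_, by simpa using hδ, ⟨by positivity, by linarith [pi_pos]⟩,
      PsiPlusEx1_lt_of_radial_ne_zero hr₀ ha (by positivity)⟩, ?_⟩⟩
  · rw [abs_of_pos (by positivity)]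
    linarith
  · obtain ⟨ε, hε, hεlt⟩ := exists_between (lt_min hδ pi_div_two_pos)
    obtain ⟨hεδ, hεπ⟩ := lt_min_iff.1 hεlt
    have hmem : π / 2 - ε ∈ Set.Ioo 0 π := ⟨by linarith, by linarith [pi_pos]⟩
    have hsin : sin (π / 2 - ε) < 1 := by
      rw [← sin_pi_div_two]
      exact sin_lt_sin_of_lt_of_le_pi_div_two (by linarith [pi_pos]) le_rfl (by linarith)
    refine ⟨0, π / 2 - ε, by simpa using hδ, ?_, hmem,
      PsiPlusEx1_lt_of_sin_lt_one a 0 hr₀.ne' (sin_pos_of_mem_Ioo hmem) hsin⟩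
    rwa [sub_sub_cancel_left, abs_neg, abs_of_pos hε]
end

section
/- Let r₀ > 0 and s ∈ ℝ, and let ε ∈ {+1,−1}. Then for (ℓ,θ) ∈ ℝ × (0,π), the point (ℓ,θ) is a critical point of Ψ_ε (i.e., both partial derivatives ∂_ℓΨ_ε(ℓ,θ) and ∂_θΨ_ε(ℓ,θ) vanish) if and only if θ = π/2 and ℓ·( ε·4·r₀³·s·cos( r₀⁴·s/(ℓ²+r₀²)² ) + (ℓ²+r₀²)^{3/2} ) = 0. In particular, (0, π/2) is a critical point of Ψ_ε for every value of s. -/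
open Real

/-- Example 2 potential Ψ_ε(ℓ,θ) = −(ε/r₀)·sin(r₀⁴s/(ℓ²+r₀²)²) − 1/(sin θ·√(ℓ²+r₀²)). -/
noncomputable def PsiEx2 (r₀ s ε ℓ θ : ℝ) : ℝ :=
  -(ε / r₀) * Real.sin (r₀ ^ 4 * s / (ℓ ^ 2 + r₀ ^ 2) ^ 2) -
    1 / (Real.sin θ * Real.sqrt (ℓ ^ 2 + r₀ ^ 2))

theorem hasDerivAt_PsiEx2_radial {r₀ : ℝ} (hr₀ : 0 < r₀) (s ε ℓ : ℝ) {θ : ℝ}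
    (hθ : Real.sin θ ≠ 0) :
    HasDerivAt (fun x => PsiEx2 r₀ s ε x θ)
      (ℓ * (ε * 4 * r₀ ^ 3 * s * Real.cos (r₀ ^ 4 * s / (ℓ ^ 2 + r₀ ^ 2) ^ 2) +
        Real.sqrt (ℓ ^ 2 + r₀ ^ 2) ^ 3 / Real.sin θ) / (ℓ ^ 2 + r₀ ^ 2) ^ 3) ℓ := by
  have hu : 0 < ℓ ^ 2 + r₀ ^ 2 := by positivity
  have hq : 0 < Real.sqrt (ℓ ^ 2 + r₀ ^ 2) := Real.sqrt_pos.2 hu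
  have hq2 := Real.sq_sqrt hu.le
  have hdu : HasDerivAt (fun x : ℝ => x ^ 2 + r₀ ^ 2) (2 * ℓ) ℓ := by
    simpa using (hasDerivAt_pow 2 ℓ).add_const (r₀ ^ 2)
  have hsin := ((((hasDerivAt_const ℓ (r₀ ^ 4 * s)).fun_div (hdu.fun_pow 2)
    (by positivity)).sin).const_mul (-(ε / r₀)))
  have hinv := (hasDerivAt_const ℓ (1 : ℝ)).fun_div
    ((hdu.sqrt hu.ne').const_mul (Real.sin θ)) (mul_ne_zero hθ hq.ne')
  refine (hsin.sub hinv).congr_deriv ?_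
  generalize Real.cos (r₀ ^ 4 * s / (ℓ ^ 2 + r₀ ^ 2) ^ 2) = c
  generalize Real.sqrt (ℓ ^ 2 + r₀ ^ 2) = q at *
  rw [← hq2]
  field_simp
  ring

theorem hasDerivAt_PsiEx2_polar {r₀ : ℝ} (hr₀ : 0 < r₀) (s ε ℓ : ℝ) {θ : ℝ}
    (hθ : Real.sin θ ≠ 0) :
    HasDerivAt (fun ϑ => PsiEx2 r₀ s ε ℓ ϑ)
      (Real.cos θ / (Real.sin θ ^ 2 * Real.sqrt (ℓ ^ 2 + r₀ ^ 2))) θ := by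
  have hq : 0 < Real.sqrt (ℓ ^ 2 + r₀ ^ 2) := Real.sqrt_pos.2 (by positivity)
  have hinv := (hasDerivAt_const θ (1 : ℝ)).fun_div
    ((Real.hasDerivAt_sin θ).mul_const (Real.sqrt (ℓ ^ 2 + r₀ ^ 2))) (mul_ne_zero hθ hq.ne')
  refine ((hasDerivAt_const θ _).sub hinv).congr_deriv ?_
  field_simp
  ring

theorem cos_eq_zero_iff_of_mem_Ioo {θ : ℝ} (hθ : θ ∈ Set.Ioo 0 π) :
    Real.cos θ = 0 ↔ θ = π / 2 := by
  refine ⟨fun h => ?_, fun h => h ▸ Real.cos_pi_div_two⟩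
  refine Real.injOn_cos ⟨hθ.1.le, hθ.2.le⟩ ⟨by positivity, by linarith [Real.pi_pos]⟩ ?_
  rw [h, Real.cos_pi_div_two]

/-- Example 2: (ℓ,θ) ∈ ℝ × (0,π) is a critical point of Ψ_ε iff θ = π/2 and
ℓ·(ε·4r₀³s·cos(r₀⁴s/(ℓ²+r₀²)²) + (ℓ²+r₀²)^{3/2}) = 0. In particular, (0, π/2)
is a critical point of Ψ_ε for every value of s. -/
theorem example2_critical_points (r₀ s ε : ℝ) (hr₀ : 0 < r₀)
    (hε : ε = 1 ∨ ε = -1) :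
    (∀ ℓ θ : ℝ, θ ∈ Set.Ioo 0 π →
      ((deriv (fun x => PsiEx2 r₀ s ε x θ) ℓ = 0 ∧
        deriv (fun ϑ => PsiEx2 r₀ s ε ℓ ϑ) θ = 0) ↔
       (θ = π / 2 ∧
        ℓ * (ε * 4 * r₀ ^ 3 * s * Real.cos (r₀ ^ 4 * s / (ℓ ^ 2 + r₀ ^ 2) ^ 2) +
          Real.sqrt (ℓ ^ 2 + r₀ ^ 2) ^ 3) = 0))) ∧
    (deriv (fun x => PsiEx2 r₀ s ε x (π / 2)) 0 = 0 ∧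
     deriv (fun ϑ => PsiEx2 r₀ s ε 0 ϑ) (π / 2) = 0) := by
  have key : ∀ ℓ θ : ℝ, θ ∈ Set.Ioo 0 π →
      ((deriv (fun x => PsiEx2 r₀ s ε x θ) ℓ = 0 ∧
        deriv (fun ϑ => PsiEx2 r₀ s ε ℓ ϑ) θ = 0) ↔
       (θ = π / 2 ∧
        ℓ * (ε * 4 * r₀ ^ 3 * s * Real.cos (r₀ ^ 4 * s / (ℓ ^ 2 + r₀ ^ 2) ^ 2) +
          Real.sqrt (ℓ ^ 2 + r₀ ^ 2) ^ 3) = 0)) := by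
    intro ℓ θ hθ
    have hsin : Real.sin θ ≠ 0 := (Real.sin_pos_of_mem_Ioo hθ).ne'
    have hu : 0 < ℓ ^ 2 + r₀ ^ 2 := by positivity
    have hden : Real.sin θ ^ 2 * Real.sqrt (ℓ ^ 2 + r₀ ^ 2) ≠ 0 :=
      mul_ne_zero (pow_ne_zero 2 hsin) (Real.sqrt_pos.2 hu).ne'
    rw [(hasDerivAt_PsiEx2_radial hr₀ s ε ℓ hsin).deriv,
      (hasDerivAt_PsiEx2_polar hr₀ s ε ℓ hsin).deriv, div_eq_zero_iff, div_eq_zero_iff,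
      or_iff_left (pow_ne_zero 3 hu.ne'), or_iff_left hden, cos_eq_zero_iff_of_mem_Ioo hθ, and_comm]
    refine and_congr_right fun h => ?_
    rw [h, Real.sin_pi_div_two, div_one]
  exact ⟨key, (key 0 (π / 2) ⟨by positivity, by linarith [Real.pi_pos]⟩).2 ⟨rfl, zero_mul _⟩⟩
end

section
/- Let r₀ > 0 and take s = 2. Then the set of critical points of Ψ₋ in ℝ × (0,π) (points where both partial derivatives vanish) consists of exactly five points, namely (ℓ, π/2) with ℓ ∈ {0, ±ℓ₁, ±ℓ₂} for exactly two distinct values 0 < ℓ₁ < ℓ₂ solving (ℓ²+r₀²)^{3/2} = 8r₀³·cos( 2r₀⁴/(ℓ²+r₀²)² ); and the set of critical points of Ψ₊ in ℝ × (0,π) consists of exactly three points, namely (ℓ, π/2) with ℓ ∈ {0, ±ℓ₃} for exactly one value ℓ₃ > 0 solving (ℓ²+r₀²)^{3/2} = −8r₀³·cos( 2r₀⁴/(ℓ²+r₀²)² ). -/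
open Real

/-- The set of critical points of Ψ_ε (for Example 2) in ℝ × (0,π). -/
noncomputable def critEx2 (r₀ s ε : ℝ) : Set (ℝ × ℝ) :=
  {p : ℝ × ℝ | p.2 ∈ Set.Ioo 0 π ∧
    deriv (fun x => PsiEx2 r₀ s ε x p.2) p.1 = 0 ∧
    deriv (fun ϑ => PsiEx2 r₀ s ε p.1 ϑ) p.2 = 0}

open Set

theorem StrictConcaveOn.not_three_zeros {s : Set ℝ} {f : ℝ → ℝ} (hf : StrictConcaveOn ℝ s f)
    {a b c : ℝ} (ha : a ∈ s) (hc : c ∈ s) (hab : a < b) (hbc : b < c)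
    (fa : f a = 0) (fb : f b = 0) (fc : f c = 0) : False := by
  have h := hf.slope_anti_adjacent ha hc hab hbc
  simp [fa, fb, fc] at h

/-- The function `y ↦ (2 / y) ^ (3 / 4)` on the positive reals. -/
noncomputable def radiusPow (y : ℝ) : ℝ := exp (3 / 4 * (log 2 - log y))

theorem radiusPow_pos (y : ℝ) : 0 < radiusPow y := exp_pos _

theorem strictAntiOn_radiusPow : StrictAntiOn radiusPow (Ioi 0) := by
  intro a ha b hb hab
  have := log_lt_log ha hab
  exact exp_lt_exp.2 (by linarith)

theorem continuousOn_radiusPow : ContinuousOn radiusPow (Ioi 0) := by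
  intro y hy
  have : y ≠ 0 := (mem_Ioi.1 hy).ne'
  unfold radiusPow
  exact ContinuousAt.continuousWithinAt (by fun_prop (disch := assumption))

theorem convexOn_radiusPow : ConvexOn ℝ (Ioi 0) radiusPow := by
  refine ⟨convex_Ioi 0, fun x hx y hy a b ha hb hab => ?_⟩
  have hlog := strictConcaveOn_log_Ioi.concaveOn.2 hx hy ha hb hab
  have hexp := convexOn_exp.2 (mem_univ (3 / 4 * (log 2 - log x)))
    (mem_univ (3 / 4 * (log 2 - log y))) ha hb hab
  refine le_trans (exp_le_exp.2 ?_) hexp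
  simp only [smul_eq_mul] at hlog ⊢
  have : a * (3 / 4 * (log 2 - log x)) + b * (3 / 4 * (log 2 - log y)) =
      3 / 4 * ((a + b) * log 2 - (a * log x + b * log y)) := by ring
  rw [this, hab]
  linarith

theorem radiusPow_one_lt : radiusPow 1 < 2 := by
  have h2 : 0 < log 2 := log_pos (by norm_num)
  rw [radiusPow, ← lt_log_iff_exp_lt (by norm_num), log_one]
  linarith

theorem radiusPow_two : radiusPow 2 = 1 := by simp [radiusPow]

theorem radiusPow_one_div_eight : radiusPow (1 / 8) = 8 := by
  have h8 : log (8 : ℝ) = 3 * log 2 := by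
    rw [show (8 : ℝ) = 2 ^ 3 by norm_num, log_pow]; norm_num
  rw [radiusPow, one_div, log_inv, h8,
    show 3 / 4 * (log 2 - -(3 * log 2)) = log 8 by rw [h8]; ring, exp_log (by norm_num)]

theorem strictConcaveOn_cos_sub_radiusPow :
    StrictConcaveOn ℝ (Ioo 0 (π / 2)) fun y => 8 * cos y - radiusPow y := by
  refine ⟨convex_Ioo _ _, fun x hx y hy hxy a b ha hb hab => ?_⟩
  have hcos := strictConcaveOn_cos_Icc.2
    (show x ∈ Icc (-(π / 2)) (π / 2) from ⟨by linarith [hx.1, hx.2], hx.2.le⟩)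
    (show y ∈ Icc (-(π / 2)) (π / 2) from ⟨by linarith [hy.1, hy.2], hy.2.le⟩) hxy ha hb hab
  have hpow := convexOn_radiusPow.2 (mem_Ioi.2 hx.1) (mem_Ioi.2 hy.1) ha.le hb.le hab
  simp only [smul_eq_mul] at *
  linarith

theorem exists_two_zeros : ∃ y₁ y₂ : ℝ, 0 < y₂ ∧ y₂ < y₁ ∧ y₁ < 2 ∧
    ∀ y : ℝ, 0 < y → y < 2 → (radiusPow y = 8 * cos y ↔ y = y₁ ∨ y = y₂) := by
  have hpi := pi_gt_three
  have hpi' := pi_lt_four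
  have hcont : ContinuousOn (fun y => 8 * cos y - radiusPow y) (Ioi 0) :=
    (continuous_const.mul continuous_cos).continuousOn.sub continuousOn_radiusPow
  have hone : 0 < 8 * cos 1 - radiusPow 1 := by
    have := one_sub_sq_div_two_le_cos (x := 1)
    linarith [radiusPow_one_lt]
  have heighth : 8 * cos (1 / 8) - radiusPow (1 / 8) < 0 := by
    have : cos (1 / 8) < 1 := by
      simpa using cos_lt_cos_of_nonneg_of_le_pi le_rfl (by linarith : (1 / 8 : ℝ) ≤ π)
        (by norm_num)
    rw [radiusPow_one_div_eight]
    linarith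
  have hhalf : 8 * cos (π / 2) - radiusPow (π / 2) < 0 := by
    rw [cos_pi_div_two]
    linarith [radiusPow_pos (π / 2)]
  obtain ⟨y₂, hy₂, h₂⟩ := intermediate_value_Ioo (by norm_num : (1 / 8 : ℝ) ≤ 1)
    (hcont.mono fun y hy => mem_Ioi.2 (by linarith [hy.1])) ⟨heighth, hone⟩
  obtain ⟨y₁, hy₁, h₁⟩ := intermediate_value_Ioo' (by linarith : (1 : ℝ) ≤ π / 2)
    (hcont.mono fun y hy => mem_Ioi.2 (by linarith [hy.1])) ⟨hhalf, hone⟩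
  have m₁ : y₁ ∈ Ioo 0 (π / 2) := ⟨by linarith [hy₁.1], hy₁.2⟩
  have m₂ : y₂ ∈ Ioo 0 (π / 2) := ⟨by linarith [hy₂.1], by linarith [hy₂.2]⟩
  have h₂₁ : y₂ < y₁ := hy₂.2.trans hy₁.1
  refine ⟨y₁, y₂, m₂.1, h₂₁, by linarith [hy₁.2], fun y hy hy' => ⟨fun h => ?_, ?_⟩⟩
  · have hlt : y < π / 2 := by
      by_contra! hle
      have := cos_nonpos_of_pi_div_two_le_of_le hle (by linarith)
      linarith [radiusPow_pos y]
    have m : y ∈ Ioo 0 (π / 2) := ⟨hy, hlt⟩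
    have h₀ : 8 * cos y - radiusPow y = 0 := by linarith
    have hconc := strictConcaveOn_cos_sub_radiusPow
    by_contra! hne
    rcases lt_or_gt_of_ne hne.2 with c | c
    · exact hconc.not_three_zeros m m₁ c h₂₁ h₀ h₂ h₁
    · rcases lt_or_gt_of_ne hne.1 with d | d
      · exact hconc.not_three_zeros m₂ m₁ c d h₂ h₀ h₁
      · exact hconc.not_three_zeros m₂ m h₂₁ d h₂ h₁ h₀
  · rintro (rfl | rfl)
    · simp only at h₁; linarith
    · simp only at h₂; linarith

theorem exists_unique_zero : ∃ y₃ : ℝ, 0 < y₃ ∧ y₃ < 2 ∧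
    ∀ y : ℝ, 0 < y → y < 2 → (radiusPow y = -(8 * cos y) ↔ y = y₃) := by
  have hpi := pi_gt_three
  have hcont : ContinuousOn (fun y => 8 * cos y + radiusPow y) (Ioi 0) :=
    (continuous_const.mul continuous_cos).continuousOn.add continuousOn_radiusPow
  have hone : 0 < 8 * cos 1 + radiusPow 1 := by
    linarith [cos_one_pos, radiusPow_pos 1]
  have htwo : 8 * cos 2 + radiusPow 2 < 0 := by
    have h := cos_two_mul 1
    rw [mul_one] at h
    rw [h, radiusPow_two]
    nlinarith [cos_one_pos, cos_one_le]
  have hanti : StrictAntiOn (fun y => 8 * cos y + radiusPow y) (Ioo 0 2) := by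
    intro a ha b hb hab
    have hcos := cos_lt_cos_of_nonneg_of_le_pi ha.1.le (by linarith [hb.2]) hab
    have hpow := strictAntiOn_radiusPow (mem_Ioi.2 ha.1) (mem_Ioi.2 hb.1) hab
    simp only
    linarith
  obtain ⟨y₃, hy₃, h₃⟩ := intermediate_value_Ioo' (by norm_num : (1 : ℝ) ≤ 2)
    (hcont.mono fun y hy => mem_Ioi.2 (by linarith [hy.1])) ⟨htwo, hone⟩
  have m₃ : y₃ ∈ Ioo 0 2 := ⟨by linarith [hy₃.1], hy₃.2⟩
  refine ⟨y₃, m₃.1, m₃.2, fun y hy hy' => ⟨fun h => ?_, ?_⟩⟩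
  · refine hanti.injOn ⟨hy, hy'⟩ m₃ ?_
    simp only at h₃ ⊢
    linarith
  · rintro rfl
    simp only at h₃
    linarith

theorem sqrt_pow_three_eq {r₀ : ℝ} (hr₀ : 0 < r₀) (ℓ : ℝ) :
    √(ℓ ^ 2 + r₀ ^ 2) ^ 3 = r₀ ^ 3 * radiusPow (2 * r₀ ^ 4 / (ℓ ^ 2 + r₀ ^ 2) ^ 2) := by
  have hρ : 0 < ℓ ^ 2 + r₀ ^ 2 := by positivity
  refine log_injOn_pos (mem_Ioi.2 (by positivity))
    (mem_Ioi.2 (mul_pos (by positivity) (radiusPow_pos _))) ?_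
  rw [log_pow, log_sqrt hρ.le, log_mul (by positivity) (radiusPow_pos _).ne', radiusPow, log_exp,
    log_div (by positivity) (by positivity), log_mul (by norm_num) (by positivity), log_pow,
    log_pow, log_pow]
  push_cast
  ring

/-- The positive `ℓ` with `2 * r₀ ^ 4 / (ℓ ^ 2 + r₀ ^ 2) ^ 2 = y`, for `0 < y < 2`. -/
noncomputable def radiusOf (r₀ y : ℝ) : ℝ := r₀ * √(√(2 / y) - 1)

theorem one_lt_sqrt_two_div {y : ℝ} (hy : 0 < y) (hy' : y < 2) : 1 < √(2 / y) := by
  rw [lt_sqrt zero_le_one, one_pow, lt_div_iff₀ hy]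
  linarith

theorem radiusOf_pos {r₀ y : ℝ} (hr₀ : 0 < r₀) (hy : 0 < y) (hy' : y < 2) :
    0 < radiusOf r₀ y :=
  mul_pos hr₀ (sqrt_pos.2 (by linarith [one_lt_sqrt_two_div hy hy']))

theorem radiusOf_lt_radiusOf {r₀ y z : ℝ} (hr₀ : 0 < r₀) (hy : 0 < y) (hyz : y < z)
    (hz : z < 2) : radiusOf r₀ z < radiusOf r₀ y := by
  have h := one_lt_sqrt_two_div (hy.trans hyz) hz
  have h' : √(2 / z) < √(2 / y) :=
    sqrt_lt_sqrt (div_pos two_pos (hy.trans hyz)).le (by gcongr)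
  exact mul_lt_mul_of_pos_left (sqrt_lt_sqrt (by linarith) (by linarith)) hr₀

theorem two_mul_div_eq_iff {r₀ ℓ y : ℝ} (hr₀ : 0 < r₀) (hℓ : 0 < ℓ) (hy : 0 < y) (hy' : y < 2) :
    2 * r₀ ^ 4 / (ℓ ^ 2 + r₀ ^ 2) ^ 2 = y ↔ ℓ = radiusOf r₀ y := by
  have hρ : 0 < ℓ ^ 2 + r₀ ^ 2 := by positivity
  constructor
  · rintro rfl
    have h₁ : √(2 / (2 * r₀ ^ 4 / (ℓ ^ 2 + r₀ ^ 2) ^ 2)) = (ℓ ^ 2 + r₀ ^ 2) / r₀ ^ 2 := by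
      rw [sqrt_eq_iff_mul_self_eq (by positivity) (by positivity)]
      field_simp
    have h₂ : √((ℓ ^ 2 + r₀ ^ 2) / r₀ ^ 2 - 1) = ℓ / r₀ := by
      rw [sqrt_eq_iff_mul_self_eq (by rw [sub_nonneg, le_div_iff₀ (by positivity)]; nlinarith)
        (by positivity)]
      field_simp
      ring
    rw [radiusOf, h₁, h₂]
    field_simp
  · rintro rfl
    have h₁ := one_lt_sqrt_two_div hy hy'
    have h₂ : radiusOf r₀ y ^ 2 + r₀ ^ 2 = r₀ ^ 2 * √(2 / y) := by
      rw [radiusOf, mul_pow, sq_sqrt (by linarith)]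
      ring
    rw [h₂, mul_pow, sq_sqrt (by positivity)]
    field_simp

theorem two_mul_div_mem_Ioo {r₀ ℓ : ℝ} (hr₀ : 0 < r₀) (hℓ : 0 < ℓ) :
    2 * r₀ ^ 4 / (ℓ ^ 2 + r₀ ^ 2) ^ 2 ∈ Ioo (0 : ℝ) 2 := by
  refine ⟨by positivity, ?_⟩
  rw [div_lt_iff₀ (by positivity)]
  have : 0 < ℓ ^ 2 * (ℓ ^ 2 + 2 * r₀ ^ 2) := by positivity
  nlinarith

theorem hasDerivAt_PsiEx2_fst {r₀ : ℝ} (hr₀ : 0 < r₀) (s ε ℓ : ℝ) {θ : ℝ} (hθ : sin θ ≠ 0) :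
    HasDerivAt (fun x => PsiEx2 r₀ s ε x θ)
      (ℓ * (4 * ε * r₀ ^ 3 * s * cos (r₀ ^ 4 * s / (ℓ ^ 2 + r₀ ^ 2) ^ 2) / (ℓ ^ 2 + r₀ ^ 2) ^ 3 +
        1 / (sin θ * √(ℓ ^ 2 + r₀ ^ 2) ^ 3))) ℓ := by
  have hρ : 0 < ℓ ^ 2 + r₀ ^ 2 := by positivity
  have hsqrt : 0 < √(ℓ ^ 2 + r₀ ^ 2) := sqrt_pos.2 hρ
  have d : HasDerivAt (fun x : ℝ => x ^ 2 + r₀ ^ 2) (2 * ℓ) ℓ := by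
    simpa using (hasDerivAt_pow 2 ℓ).add_const (r₀ ^ 2)
  have d₁ := (((hasDerivAt_const ℓ (r₀ ^ 4 * s)).fun_div (d.fun_pow 2)
    (by positivity)).sin).const_mul (-(ε / r₀))
  have d₂ := (hasDerivAt_const ℓ (1 : ℝ)).fun_div ((d.sqrt hρ.ne').const_mul (sin θ))
    (mul_ne_zero hθ hsqrt.ne')
  refine (d₁.fun_sub d₂).congr_deriv ?_
  field_simp
  ring

theorem hasDerivAt_PsiEx2_snd {r₀ : ℝ} (hr₀ : 0 < r₀) (s ε ℓ : ℝ) {θ : ℝ} (hθ : sin θ ≠ 0) :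
    HasDerivAt (fun ϑ => PsiEx2 r₀ s ε ℓ ϑ)
      (cos θ / (sin θ ^ 2 * √(ℓ ^ 2 + r₀ ^ 2))) θ := by
  have hsqrt : 0 < √(ℓ ^ 2 + r₀ ^ 2) := sqrt_pos.2 (by positivity)
  have d := (hasDerivAt_const θ (1 : ℝ)).fun_div
    ((hasDerivAt_sin θ).mul_const (√(ℓ ^ 2 + r₀ ^ 2))) (mul_ne_zero hθ hsqrt.ne')
  refine (d.const_sub (-(ε / r₀) * sin (r₀ ^ 4 * s / (ℓ ^ 2 + r₀ ^ 2) ^ 2))).congr_deriv ?_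
  field_simp
  ring

theorem mem_critEx2_iff {r₀ : ℝ} (hr₀ : 0 < r₀) (s ε ℓ θ : ℝ) :
    (ℓ, θ) ∈ critEx2 r₀ s ε ↔ θ = π / 2 ∧ (ℓ = 0 ∨ √(ℓ ^ 2 + r₀ ^ 2) ^ 3 =
      -(ε * (4 * r₀ ^ 3 * s * cos (r₀ ^ 4 * s / (ℓ ^ 2 + r₀ ^ 2) ^ 2)))) := by
  have hρ : 0 < ℓ ^ 2 + r₀ ^ 2 := by positivity
  have hsqrt : 0 < √(ℓ ^ 2 + r₀ ^ 2) := sqrt_pos.2 hρ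
  have hfst : deriv (fun x => PsiEx2 r₀ s ε x (π / 2)) ℓ = 0 ↔ ℓ = 0 ∨ √(ℓ ^ 2 + r₀ ^ 2) ^ 3 =
      -(ε * (4 * r₀ ^ 3 * s * cos (r₀ ^ 4 * s / (ℓ ^ 2 + r₀ ^ 2) ^ 2))) := by
    rw [(hasDerivAt_PsiEx2_fst hr₀ s ε ℓ (by simp)).deriv, mul_eq_zero]
    refine or_congr Iff.rfl ?_
    have hcube : (ℓ ^ 2 + r₀ ^ 2) ^ 3 = √(ℓ ^ 2 + r₀ ^ 2) ^ 3 * √(ℓ ^ 2 + r₀ ^ 2) ^ 3 := by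
      rw [← mul_pow, mul_self_sqrt hρ.le]
    have hne : √(ℓ ^ 2 + r₀ ^ 2) ^ 3 ≠ 0 := by positivity
    rw [hcube, sin_pi_div_two, one_mul]
    generalize √(ℓ ^ 2 + r₀ ^ 2) ^ 3 = w at *
    generalize cos _ = c
    rw [div_add_div _ _ (mul_ne_zero hne hne) hne, div_eq_zero_iff, or_iff_left (by positivity),
      show 4 * ε * r₀ ^ 3 * s * c * w + w * w * 1 = w * (4 * ε * r₀ ^ 3 * s * c + w) by ring,
      mul_eq_zero, or_iff_right hne]
    constructor <;> intro h <;> linarith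
  simp only [critEx2, mem_ofPred_eq]
  constructor
  · rintro ⟨hθ, h₁, h₂⟩
    have hsin : sin θ ≠ 0 := (sin_pos_of_mem_Ioo hθ).ne'
    rw [(hasDerivAt_PsiEx2_snd hr₀ s ε ℓ hsin).deriv, div_eq_zero_iff,
      or_iff_left (by positivity)] at h₂
    have hθ' : θ = π / 2 := injOn_cos ⟨hθ.1.le, hθ.2.le⟩
      ⟨by positivity, by linarith [pi_pos]⟩ (by rw [h₂, cos_pi_div_two])
    subst hθ'
    exact ⟨rfl, hfst.1 h₁⟩
  · rintro ⟨rfl, h⟩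
    refine ⟨⟨by positivity, by linarith [pi_pos]⟩, hfst.2 h, ?_⟩
    rw [(hasDerivAt_PsiEx2_snd hr₀ s ε ℓ (by simp)).deriv, cos_pi_div_two, zero_div]

/-- An even condition on `ℓ ≠ 0` is determined by its positive solutions. -/
theorem eq_zero_or_iff_of_even {P : ℝ → Prop} (hP : ∀ ℓ, P (-ℓ) ↔ P ℓ) {S : Set ℝ}
    (hS : ∀ ℓ, 0 < ℓ → (P ℓ ↔ ℓ ∈ S)) (hpos : ∀ ℓ ∈ S, 0 < ℓ) (ℓ : ℝ) :
    ℓ = 0 ∨ P ℓ ↔ ℓ = 0 ∨ ℓ ∈ S ∨ -ℓ ∈ S := by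
  rcases lt_trichotomy ℓ 0 with h | h | h
  · have hn : ℓ ∉ S := fun hm => (hpos ℓ hm).not_gt h
    rw [← hP, hS (-ℓ) (by linarith)]
    tauto
  · simp [h]
  · have hn : -ℓ ∉ S := fun hm => by linarith [hpos _ hm]
    rw [hS ℓ h]
    tauto

/-- Example 2 with s = 2: Ψ₋ has exactly five critical points (photon circles),
at (ℓ, π/2) with ℓ ∈ {0, ±ℓ₁, ±ℓ₂} for exactly two positive solutions
0 < ℓ₁ < ℓ₂ of (ℓ²+r₀²)^{3/2} = 8r₀³·cos(2r₀⁴/(ℓ²+r₀²)²), and Ψ₊ has exactly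
three critical points, at (ℓ, π/2) with ℓ ∈ {0, ±ℓ₃} for exactly one positive
solution ℓ₃ of (ℓ²+r₀²)^{3/2} = −8r₀³·cos(2r₀⁴/(ℓ²+r₀²)²). -/
theorem example2_s_two_photon_circles (r₀ : ℝ) (hr₀ : 0 < r₀) :
    (∃ ℓ₁ ℓ₂ : ℝ, 0 < ℓ₁ ∧ ℓ₁ < ℓ₂ ∧
      (∀ ℓ : ℝ, 0 < ℓ →
        (Real.sqrt (ℓ ^ 2 + r₀ ^ 2) ^ 3 =
            8 * r₀ ^ 3 * Real.cos (2 * r₀ ^ 4 / (ℓ ^ 2 + r₀ ^ 2) ^ 2) ↔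
          ℓ = ℓ₁ ∨ ℓ = ℓ₂)) ∧
      critEx2 r₀ 2 (-1) =
        {(0, π / 2), (ℓ₁, π / 2), (-ℓ₁, π / 2), (ℓ₂, π / 2), (-ℓ₂, π / 2)}) ∧
    (∃ ℓ₃ : ℝ, 0 < ℓ₃ ∧
      (∀ ℓ : ℝ, 0 < ℓ →
        (Real.sqrt (ℓ ^ 2 + r₀ ^ 2) ^ 3 =
            -(8 * r₀ ^ 3 * Real.cos (2 * r₀ ^ 4 / (ℓ ^ 2 + r₀ ^ 2) ^ 2)) ↔
          ℓ = ℓ₃)) ∧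
      critEx2 r₀ 2 1 = {(0, π / 2), (ℓ₃, π / 2), (-ℓ₃, π / 2)}) := by
  have hcubic : ∀ ℓ c : ℝ, √(ℓ ^ 2 + r₀ ^ 2) ^ 3 = 8 * r₀ ^ 3 * c ↔
      radiusPow (2 * r₀ ^ 4 / (ℓ ^ 2 + r₀ ^ 2) ^ 2) = 8 * c := fun ℓ c => by
    rw [sqrt_pow_three_eq hr₀, show 8 * r₀ ^ 3 * c = r₀ ^ 3 * (8 * c) by ring,
      mul_right_inj' (by positivity)]
  constructor
  · obtain ⟨y₁, y₂, hy₂, h₂₁, hy₁, hy⟩ := exists_two_zeros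
    have hsol : ∀ ℓ : ℝ, 0 < ℓ → (√(ℓ ^ 2 + r₀ ^ 2) ^ 3 =
        8 * r₀ ^ 3 * cos (2 * r₀ ^ 4 / (ℓ ^ 2 + r₀ ^ 2) ^ 2) ↔
        ℓ = radiusOf r₀ y₁ ∨ ℓ = radiusOf r₀ y₂) := fun ℓ hℓ => by
      have hm := two_mul_div_mem_Ioo hr₀ hℓ
      rw [hcubic, hy _ hm.1 hm.2, two_mul_div_eq_iff hr₀ hℓ (hy₂.trans h₂₁) hy₁,
        two_mul_div_eq_iff hr₀ hℓ hy₂ (h₂₁.trans hy₁)]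
    have hp₁ := radiusOf_pos hr₀ (hy₂.trans h₂₁) hy₁
    have hp₂ := radiusOf_pos hr₀ hy₂ (h₂₁.trans hy₁)
    refine ⟨radiusOf r₀ y₁, radiusOf r₀ y₂, hp₁, radiusOf_lt_radiusOf hr₀ hy₂ h₂₁ hy₁, hsol, ?_⟩
    ext ⟨ℓ, θ⟩
    have key := eq_zero_or_iff_of_even (P := fun ℓ => √(ℓ ^ 2 + r₀ ^ 2) ^ 3 =
        8 * r₀ ^ 3 * cos (2 * r₀ ^ 4 / (ℓ ^ 2 + r₀ ^ 2) ^ 2)) (by simp)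
      (S := {radiusOf r₀ y₁, radiusOf r₀ y₂}) hsol
      (by rintro ℓ (rfl | rfl) <;> assumption) ℓ
    rw [mem_critEx2_iff hr₀, mul_comm (r₀ ^ 4), show ∀ c : ℝ,
      -(-1 * (4 * r₀ ^ 3 * 2 * c)) = 8 * r₀ ^ 3 * c from fun c => by ring, key]
    simp only [mem_insert_iff, mem_singleton_iff, Prod.mk.injEq, neg_eq_iff_eq_neg]
    tauto
  · obtain ⟨y₃, hy₃, hy₃', hy⟩ := exists_unique_zero
    have hsol : ∀ ℓ : ℝ, 0 < ℓ → (√(ℓ ^ 2 + r₀ ^ 2) ^ 3 =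
        -(8 * r₀ ^ 3 * cos (2 * r₀ ^ 4 / (ℓ ^ 2 + r₀ ^ 2) ^ 2)) ↔
        ℓ = radiusOf r₀ y₃) := fun ℓ hℓ => by
      have hm := two_mul_div_mem_Ioo hr₀ hℓ
      rw [← mul_neg, hcubic, mul_neg, hy _ hm.1 hm.2, two_mul_div_eq_iff hr₀ hℓ hy₃ hy₃']
    have hp₃ := radiusOf_pos hr₀ hy₃ hy₃'
    refine ⟨radiusOf r₀ y₃, hp₃, hsol, ?_⟩
    ext ⟨ℓ, θ⟩
    have key := eq_zero_or_iff_of_even (P := fun ℓ => √(ℓ ^ 2 + r₀ ^ 2) ^ 3 =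
        -(8 * r₀ ^ 3 * cos (2 * r₀ ^ 4 / (ℓ ^ 2 + r₀ ^ 2) ^ 2))) (by simp)
      (S := {radiusOf r₀ y₃}) hsol (by rintro ℓ rfl; assumption) ℓ
    rw [mem_critEx2_iff hr₀, mul_comm (r₀ ^ 4), show ∀ c : ℝ,
      -(1 * (4 * r₀ ^ 3 * 2 * c)) = -(8 * r₀ ^ 3 * c) from fun c => by ring, key]
    simp only [mem_insert_iff, mem_singleton_iff, Prod.mk.injEq, neg_eq_iff_eq_neg]
    tauto
end
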